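/- arXiv:2209.13835 — 2 statements merged into one kernel-verified Lean document; each statement's English description precedes it below -/
import Mathlib

section
/- Let E and F be bounded operators on a Banach space with g-Drazin inverses, and suppose EF^2 = 0 and EFE = 0. Then the anti-triangular block operator matrix M = [[E, I], [F, 0]] has a g-Drazin inverse. -/
open Filter Topology

/-- An element of a normed ring is quasinilpotent if `‖a^n‖^(1/n) → 0`. -/
def IsQuasinilpotent {A : Type*} [NormedRing A] (a : A) : Prop :=
  Filter.Tendsto (fun n : ℕ => ‖a ^ n‖ ^ ((1 : ℝ) / n)) Filter.atTop (nhds 0)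

/-- `b` is a generalized Drazin inverse of `a`. -/
def IsGDrazinInverse {A : Type*} [NormedRing A] (a b : A) : Prop :=
  a * b = b * a ∧ b * a * b = b ∧ IsQuasinilpotent (a - a ^ 2 * b)

/-- The block operator matrix `[[a, b], [c, d]]` acting on `X × X`. -/
noncomputable def blk {X : Type*} [NormedAddCommGroup X] [NormedSpace ℂ X]
    (a b c d : X →L[ℂ] X) : (X × X) →L[ℂ] (X × X) :=
  ((a.comp (ContinuousLinearMap.fst ℂ X X)) + (b.comp (ContinuousLinearMap.snd ℂ X X))).prod
    ((c.comp (ContinuousLinearMap.fst ℂ X X)) + (d.comp (ContinuousLinearMap.snd ℂ X X)))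


section Helpers

open Metric Complex

variable {A : Type*} [NormedRing A] [NormedAlgebra ℂ A] [CompleteSpace A]

lemma gd_isUnit_of_qn {x : A} (h : IsQuasinilpotent x) {l : ℂ} (hl : l ≠ 0) :
    IsUnit (algebraMap ℂ A l - x) := by
  have h1 := spectrum.pow_norm_pow_one_div_tendsto_nhds_spectralRadius x
  have h2 := (ENNReal.continuous_ofReal.tendsto (0 : ℝ)).comp h
  have h3 : spectralRadius ℂ x = 0 := by
    rw [tendsto_nhds_unique h1 h2]; simp
  have : l ∈ resolventSet ℂ x := by
    apply spectrum.mem_resolventSet_of_spectralRadius_lt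
    rw [h3]; simpa using hl
  exact this

lemma gd_isUnit_near {a b : A} (h : IsGDrazinInverse a b) :
    ∃ r > 0, ∀ l : ℂ, l ≠ 0 → ‖l‖ < r → IsUnit (algebraMap ℂ A l - a) := by
  obtain ⟨hc, hb, hq⟩ := h
  refine ⟨(‖b‖ + 1)⁻¹, by positivity, fun l hl hlr => ?_⟩
  obtain ⟨u, hu⟩ := gd_isUnit_of_qn hq hl
  have hn : ‖l • b‖ < 1 := by
    rw [norm_smul]
    have hp : 0 < ‖b‖ + 1 := by positivity
    have := (lt_inv_comm₀ (norm_pos_iff.2 hl) hp).1 hlr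
    have h1 : ‖l‖ * (‖b‖ + 1) < 1 := by
      have := mul_lt_mul_of_pos_right hlr hp
      rwa [inv_mul_cancel₀ hp.ne'] at this
    nlinarith [norm_pos_iff.2 hl]
  obtain ⟨v, hv⟩ := isUnit_one_sub_of_norm_lt_one hn
  set L := algebraMap ℂ A l with hL
  have hLc : ∀ x : A, L * x = x * L := fun x => Algebra.commutes l x
  have hlb : l • b = L * b := Algebra.smul_def l b
  rw [hlb] at hv
  have hab : a * b * b = b := by rw [hc, hb]
  have hbab : b * (a * b) = b := by rw [← mul_assoc, hb]
  have hidem : a * b * (a * b) = a * b := by rw [mul_assoc, hbab]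
  have cL : ∀ x : A, Commute x L := fun x => (hLc x).symm
  have cab : Commute (L - a) b := (cL b).symm.sub_left hc
  have caa : Commute (L - a) a := (cL a).symm.sub_left (Commute.refl a)
  have cv : Commute (L - a) (v : A) := by
    rw [hv]
    exact (Commute.one_right _).sub_right ((cL _).mul_right cab)
  have cu : Commute (L - a) (u : A) := by
    rw [hu]
    exact (cL _).sub_right (caa.sub_right ((caa.pow_right 2).mul_right cab))
  have e1 : (L - a) * (1 - a * b) = u * (1 - a * b) := by
    rw [hu]
    have : (a ^ 2 * b) * (1 - a * b) = 0 := by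
      rw [mul_sub, mul_one, pow_two, mul_assoc a a b, mul_assoc a (a * b), hidem, sub_self]
    rw [sub_mul (L) (a - a ^ 2 * b), sub_mul a, this, sub_zero, ← sub_mul]
  have e2 : (L - a) * b = - (v * (a * b)) := by
    rw [hv, sub_mul, sub_mul, one_mul, mul_assoc L b, hbab]; abel
  have cu' := cu.units_inv_right
  have cv' := cv.units_inv_right
  have key : (L - a) * ((↑u⁻¹ : A) * (1 - a * b) - ↑v⁻¹ * b) = 1 := by
    rw [mul_sub, ← mul_assoc, cu'.eq, mul_assoc, e1, ← mul_assoc, ← mul_assoc, cv'.eq, mul_assoc _ _ b,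
      e2, mul_neg, ← mul_assoc (↑v⁻¹ : A)]
    simp
  have call : Commute (L - a) ((↑u⁻¹ : A) * (1 - a * b) - ↑v⁻¹ * b) :=
    (cu'.mul_right ((Commute.one_right _).sub_right (caa.mul_right cab))).sub_right
      (cv'.mul_right cab)
  exact ⟨⟨_, _, key, by rw [← call.eq, key]⟩, rfl⟩

lemma gd_qn_of_bound {x : A} {ρ : ℝ} (hρ : 0 < ρ)
    (h : ∀ r, 0 < r → r < ρ → ∃ K : ℝ, ∀ n : ℕ, 1 ≤ n → ‖x ^ n‖ ≤ K * r ^ n) :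
    IsQuasinilpotent x := by
  unfold IsQuasinilpotent
  rw [Metric.tendsto_atTop]
  intro ε hε
  set r := min (ε / 4) (ρ / 2) with hr
  have hr0 : 0 < r := by positivity
  have hr1 : r ≤ ε / 4 := min_le_left _ _
  have hr2 : r ≤ ρ / 2 := min_le_right _ _
  obtain ⟨K, hK⟩ := h r hr0 (by linarith)
  obtain ⟨N, hN⟩ := pow_unbounded_of_one_lt K (one_lt_two)
  refine ⟨N + 1, fun n hn => ?_⟩
  have hn0 : n ≠ 0 := by omega
  have h1 : ‖x ^ n‖ ≤ (2 * r) ^ n := by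
    rw [mul_pow]
    refine (hK n (by omega)).trans ?_
    gcongr
    exact hN.le.trans (pow_le_pow_right₀ (by norm_num) (by omega))
  have h2 : ‖x ^ n‖ ^ ((1 : ℝ) / n) ≤ 2 * r := by
    calc _ ≤ ((2 * r) ^ n) ^ ((1 : ℝ) / n) :=
          Real.rpow_le_rpow (norm_nonneg _) h1 (by positivity)
      _ = 2 * r := by rw [one_div]; exact Real.pow_rpow_inv_natCast (by positivity) hn0
  rw [Real.dist_eq, sub_zero, abs_of_nonneg (by positivity)]
  linarith

/-- Laurent coefficients of the resolvent. -/
noncomputable def gdCf (a : A) (r : ℝ) (n : ℤ) : A :=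
  (2 * Real.pi * I : ℂ)⁻¹ • ∮ z in C(0, r), z ^ n • resolvent a z

lemma gd_clm_circle (L : A →L[ℂ] A) {f : ℂ → A} {r : ℝ} (hf : CircleIntegrable f 0 r) :
    L (∮ z in C(0, r), f z) = ∮ z in C(0, r), L (f z) := by
  unfold circleIntegral
  rw [← L.intervalIntegral_comp_comm hf.out]
  simp

section Res

variable {a : A} {ρ : ℝ} (hρ : ∀ l : ℂ, l ≠ 0 → ‖l‖ < ρ → IsUnit (algebraMap ℂ A l - a))

include hρ

lemma gd_diff {z : ℂ} (hz : z ≠ 0) (hz' : ‖z‖ < ρ) (n : ℤ) :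
    DifferentiableAt ℂ (fun z => z ^ n • resolvent a z) z := by
  have h1 : DifferentiableAt ℂ (resolvent a) z :=
    (spectrum.hasDerivAt_resolvent_const_left (hρ z hz hz')).differentiableAt
  exact (differentiableAt_zpow.2 (Or.inl hz)).smul h1

lemma gd_contOn {r : ℝ} (hr : 0 < r) (hr' : r < ρ) (n : ℤ) :
    ContinuousOn (fun z : ℂ => z ^ n • resolvent a z) (sphere 0 r) := by
  intro z hz
  have : ‖z‖ = r := by simpa using hz
  refine (gd_diff hρ ?_ (by linarith) n).continuousAt.continuousWithinAt
  rintro rfl; simp at this; linarith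

lemma gd_integrable {r : ℝ} (hr : 0 < r) (hr' : r < ρ) (n : ℤ) :
    CircleIntegrable (fun z => z ^ n • resolvent a z) 0 r :=
  (gd_contOn hρ hr hr' n).circleIntegrable hr.le

lemma gd_mul_cf {r : ℝ} (hr : 0 < r) (hr' : r < ρ) (n : ℤ) :
    a * gdCf a r n = gdCf a r (n + 1) - if n = -1 then 1 else 0 := by
  have hi : CircleIntegrable (fun z : ℂ => z ^ n • (1 : A)) 0 r := by
    apply ContinuousOn.circleIntegrable hr.le
    intro z hz
    have : ‖z‖ = r := by simpa using hz
    have hz0 : z ≠ 0 := by rintro rfl; simp at this; linarith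
    exact ((continuousAt_zpow₀ z n (Or.inl hz0)).smul continuousAt_const).continuousWithinAt
  have h1 : a * (∮ z in C(0, r), z ^ n • resolvent a z)
      = (∮ z in C(0, r), z ^ (n + 1) • resolvent a z) - ∮ z in C(0, r), z ^ n • (1 : A) := by
    rw [← circleIntegral.integral_sub (gd_integrable hρ hr hr' _) hi]
    have := gd_clm_circle (ContinuousLinearMap.mul ℂ A a) (gd_integrable hρ hr hr' n)
    simp only [ContinuousLinearMap.mul_apply'] at this
    rw [this]
    apply circleIntegral.integral_congr hr.le
    intro z hz
    have : ‖z‖ = r := by simpa using hz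
    have hz0 : z ≠ 0 := by rintro rfl; simp at this; linarith
    have hu := Ring.mul_inverse_cancel _ (hρ z hz0 (by linarith))
    rw [sub_mul, sub_eq_iff_eq_add, ← Algebra.smul_def] at hu
    have hu' : a * resolvent a z = z • resolvent a z - 1 := by
      rw [eq_sub_iff_add_eq, add_comm]; exact hu.symm
    simp only [mul_smul_comm, hu', smul_sub, smul_smul, zpow_add_one₀ hz0]
  have h2 : (2 * Real.pi * I : ℂ)⁻¹ • (∮ z in C(0, r), z ^ n • (1 : A))
      = if n = -1 then 1 else 0 := by
    rw [circleIntegral.integral_smul_const]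
    split_ifs with hn
    · subst hn
      have := circleIntegral.integral_sub_center_inv 0 hr.ne'
      simp only [sub_zero] at this
      simp only [zpow_neg_one, this]
      rw [smul_smul, inv_mul_cancel₀ Complex.two_pi_I_ne_zero, one_smul]
    · have := circleIntegral.integral_sub_zpow_of_ne hn 0 0 r
      simp only [sub_zero] at this
      rw [this]; simp
  unfold gdCf
  rw [mul_smul_comm, h1, smul_sub, h2]

lemma gd_comm_cf {r : ℝ} (hr : 0 < r) (hr' : r < ρ) (n : ℤ) :
    a * gdCf a r n = gdCf a r n * a := by
  unfold gdCf
  rw [mul_smul_comm, smul_mul_assoc]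
  congr 1
  have e1 := gd_clm_circle (ContinuousLinearMap.mul ℂ A a) (gd_integrable hρ hr hr' n)
  have e2 := gd_clm_circle ((ContinuousLinearMap.mul ℂ A).flip a) (gd_integrable hρ hr hr' n)
  simp only [ContinuousLinearMap.mul_apply', ContinuousLinearMap.flip_apply] at e1 e2
  rw [e1, e2]
  apply circleIntegral.integral_congr hr.le
  intro z hz
  have : ‖z‖ = r := by simpa using hz
  have hz0 : z ≠ 0 := by rintro rfl; simp at this; linarith
  have hu := hρ z hz0 (by linarith)
  have hc : Commute (algebraMap ℂ A z - a) a :=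
    Commute.sub_left (show Commute _ _ from Algebra.commutes z a) (Commute.refl a)
  have hc2 : Commute (Ring.inverse (algebraMap ℂ A z - a)) a := by
    obtain ⟨u, hu⟩ := hu
    rw [← hu] at hc ⊢
    rw [Ring.inverse_unit]
    exact hc.units_inv_left
  simp only [mul_smul_comm, smul_mul_assoc]
  congr 1
  exact hc2.eq.symm

lemma gd_bound_cf {r : ℝ} (hr : 0 < r) (hr' : r < ρ) :
    ∃ K : ℝ, 0 ≤ K ∧ ∀ n : ℤ, ‖gdCf a r n‖ ≤ K * r ^ n := by
  obtain ⟨C, hC⟩ := (isCompact_sphere (0 : ℂ) r).exists_bound_of_continuousOn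
    (gd_contOn hρ hr hr' 0)
  have hC0 : 0 ≤ C := (norm_nonneg _).trans (hC (r : ℂ) (by simp [abs_of_pos hr]))
  refine ⟨r * C, by positivity, fun n => ?_⟩
  rw [mul_assoc]
  apply circleIntegral.norm_two_pi_i_inv_smul_integral_le_of_norm_le_const hr.le
  intro z hz
  have h1 := hC z hz
  have : ‖z‖ = r := by simpa using hz
  rw [norm_smul, norm_zpow, this, mul_comm]
  simp only [zpow_zero, one_smul] at h1
  gcongr

lemma gd_indep {r s : ℝ} (hr : 0 < r) (hrs : r ≤ s) (hs : s < ρ) :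
    gdCf a s 0 = gdCf a r 0 := by
  unfold gdCf
  congr 1
  have hd : ∀ z ∈ closedBall (0 : ℂ) s \ ball 0 r,
      DifferentiableAt ℂ (fun z => z ^ (1 : ℤ) • resolvent a z) z := by
    intro z hz
    have h1 : ‖z‖ ≤ s := by simpa using hz.1
    have h2 : r ≤ ‖z‖ := by simpa using hz.2
    exact gd_diff hρ (norm_pos_iff.1 (by linarith)) (by linarith) 1
  have := Complex.circleIntegral_sub_center_inv_smul_eq_of_differentiable_on_annulus_off_countable
    (c := 0) hr hrs (f := fun z => z ^ (1 : ℤ) • resolvent a z) (s := ∅) Set.countable_empty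
    (fun z hz => (hd z hz).continuousAt.continuousWithinAt)
    (fun z hz => hd z ⟨ball_subset_closedBall hz.1.1, fun h => hz.1.2 (ball_subset_closedBall h)⟩)
  have conv : ∀ t : ℝ, 0 < t → (∮ z in C(0, t), (z - 0)⁻¹ • z ^ (1 : ℤ) • resolvent a z)
      = ∮ z in C(0, t), z ^ (0 : ℤ) • resolvent a z := by
    intro t ht
    apply circleIntegral.integral_congr ht.le
    intro z hz
    have : ‖z‖ = t := by simpa using hz
    have hz0 : z ≠ 0 := by rintro rfl; simp at this; linarith
    simp [smul_smul, hz0]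
  rw [conv s (by linarith), conv r hr] at this
  exact this

lemma gd_pow_cf {r : ℝ} (hr : 0 < r) (hr' : r < ρ) (N : ℕ) :
    a ^ N * gdCf a r 0 = gdCf a r N := by
  induction N with
  | zero => simp
  | succ k ih =>
    rw [pow_succ', mul_assoc, ih, gd_mul_cf hρ hr hr', if_neg (by omega), sub_zero]
    push_cast; rfl

lemma gd_pow_cf_neg {r : ℝ} (hr : 0 < r) (hr' : r < ρ) (N : ℕ) :
    a ^ N * gdCf a r (-1 - N) = gdCf a r (-1) := by
  induction N with
  | zero => simp
  | succ k ih =>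
    rw [pow_succ, mul_assoc, gd_mul_cf hρ hr hr', if_neg (by push_cast; omega), sub_zero, ← ih]
    congr 2; push_cast; ring

lemma gd_exists (hρ0 : 0 < ρ) : ∃ b, IsGDrazinInverse a b := by
  obtain ⟨s, hs0, hs1⟩ := exists_between hρ0
  set p := gdCf a s 0 with hp
  set c := gdCf a s (-1) with hcdef
  have hap : a * p = p * a := gd_comm_cf hρ hs0 hs1 0
  have hac : a * c = c * a := gd_comm_cf hρ hs0 hs1 (-1)
  have hacp : a * c = p - 1 := by
    have := gd_mul_cf hρ hs0 hs1 (-1); simpa using this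
  have hb : ∀ r, 0 < r → r < s → ∃ K : ℝ, 0 ≤ K ∧ ∀ n : ℕ, ‖a ^ n * p‖ ≤ K * r ^ n := by
    intro r hr hrs
    obtain ⟨K, hK0, hK⟩ := gd_bound_cf hρ hr (hrs.trans hs1)
    refine ⟨K, hK0, fun n => ?_⟩
    rw [hp, gd_indep hρ hr hrs.le hs1, gd_pow_cf hρ hr (hrs.trans hs1)]
    simpa using hK n
  have hpc : p * c = 0 := by
    obtain ⟨K, hK0, hK⟩ := hb (s / 2) (by positivity) (by linarith)
    obtain ⟨K', hK0', hK'⟩ := gd_bound_cf hρ hs0 hs1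
    have hle : ∀ n : ℕ, ‖p * c‖ ≤ (K * K' * s⁻¹) * (1 / 2) ^ n := by
      intro n
      have hcm : Commute a p := hap
      rw [hcdef, ← gd_pow_cf_neg hρ hs0 hs1 n, ← mul_assoc, ← (hcm.pow_left n).eq]
      refine (norm_mul_le _ _).trans ?_
      refine (mul_le_mul (hK n) (hK' _) (norm_nonneg _) (by positivity)).trans ?_
      rw [zpow_sub₀ hs0.ne', zpow_neg_one, zpow_natCast, div_pow, div_pow, one_pow]
      apply le_of_eq
      field_simp
    have ht : Tendsto (fun n : ℕ => (K * K' * s⁻¹) * (1 / 2 : ℝ) ^ n) atTop (𝓝 0) := by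
      simpa using (tendsto_pow_atTop_nhds_zero_of_lt_one (by norm_num : (0 : ℝ) ≤ 1 / 2)
        (by norm_num)).const_mul (K * K' * s⁻¹)
    have := ge_of_tendsto' ht hle
    simpa using this
  have hpp : p * p = p := by
    have : p * (a * c) = 0 := by rw [← mul_assoc, ← hap, mul_assoc, hpc, mul_zero]
    rw [hacp, mul_sub, mul_one, sub_eq_zero] at this
    exact this
  refine ⟨-c, by simp [hac], ?_, ?_⟩
  · simp only [neg_mul, mul_neg, neg_neg]
    rw [← hac, hacp, sub_mul, one_mul, hpc, zero_sub]
  · have e : a - a ^ 2 * -c = a * p := by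
      rw [mul_neg, pow_two, mul_assoc, hacp, mul_sub, mul_one]; abel
    rw [e]
    apply gd_qn_of_bound hs0
    intro r hr hrs
    obtain ⟨K, -, hK⟩ := hb r hr hrs
    refine ⟨K, fun n hn => ?_⟩
    have hcm : Commute a p := hap
    have hpn : p ^ n = p := (show IsIdempotentElem p from hpp).pow_eq (by omega)
    rw [hcm.mul_pow, hpn]
    exact hK n

end Res

lemma gd_quad {E F : A} {l : ℂ} (hl : l ≠ 0) (h1 : E * F ^ 2 = 0) (h2 : E * F * E = 0)
    (hE : IsUnit (algebraMap ℂ A l - E)) (hF : IsUnit (algebraMap ℂ A (l ^ 2) - F)) :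
    IsUnit (l ^ 2 • (1 : A) - l • E - F) := by
  have h3 : E * F * F = 0 := by rw [mul_assoc, ← pow_two, h1]
  have h4 : E * F * (E * F) = 0 := by rw [← mul_assoc, h2, zero_mul]
  set W := E * F with hW
  have hWu : IsUnit (l • (1 : A) + (l ^ 2)⁻¹ • W) := by
    refine ⟨⟨_, l⁻¹ • (1 : A) - ((l ^ 2)⁻¹ * l⁻¹ * l⁻¹) • W, ?_, ?_⟩, rfl⟩
    · simp only [mul_sub, add_mul, smul_mul_assoc, mul_smul_comm, one_mul, mul_one, smul_smul, h4,
        smul_zero, add_zero]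
      have e1 : l⁻¹ * l = 1 := inv_mul_cancel₀ hl
      have e2 : (l ^ 2)⁻¹ * l⁻¹ * l⁻¹ * l = l⁻¹ * (l ^ 2)⁻¹ := by field_simp
      match_scalars <;> field_simp <;> ring
    · simp only [sub_mul, mul_add, smul_mul_assoc, mul_smul_comm, one_mul, mul_one, smul_smul, h4,
        smul_zero, add_zero]
      have e1 : l * l⁻¹ = 1 := mul_inv_cancel₀ hl
      have e2 : l * ((l ^ 2)⁻¹ * l⁻¹ * l⁻¹) = (l ^ 2)⁻¹ * l⁻¹ := by field_simp
      match_scalars <;> field_simp <;> ring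
  have key : (algebraMap ℂ A l - E) * (algebraMap ℂ A (l ^ 2) - F)
      = (l • (1 : A) + (l ^ 2)⁻¹ • W) * (l ^ 2 • (1 : A) - l • E - F) := by
    simp only [Algebra.algebraMap_eq_smul_one, mul_sub, sub_mul, add_mul, smul_mul_assoc,
      mul_smul_comm, one_mul, mul_one, smul_smul, h2, h3, smul_zero]
    have e1 : l ^ 2 * (l ^ 2)⁻¹ = 1 := mul_inv_cancel₀ (pow_ne_zero 2 hl)
    rw [← hW]
    match_scalars <;> field_simp
  have := hE.mul hF
  rw [key] at this
  obtain ⟨u, hu⟩ := hWu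
  rw [← hu] at this
  exact (Units.isUnit_units_mul u _).1 this

end Helpers

theorem stmt2 {X : Type*} [NormedAddCommGroup X] [NormedSpace ℂ X] [CompleteSpace X]
    (E F : X →L[ℂ] X) (hE : ∃ e, IsGDrazinInverse E e) (hF : ∃ f, IsGDrazinInverse F f)
    (h1 : E * F ^ 2 = 0) (h2 : E * F * E = 0) :
    ∃ m, IsGDrazinInverse (blk E 1 F 0) m := by
  obtain ⟨e, he⟩ := hE
  obtain ⟨f, hf⟩ := hF
  obtain ⟨r₁, hr₁, H₁⟩ := gd_isUnit_near he
  obtain ⟨r₂, hr₂, H₂⟩ := gd_isUnit_near hf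
  have hpos : 0 < min r₁ (min r₂ 1) := by positivity
  refine gd_exists (ρ := min r₁ (min r₂ 1)) (fun l hl hlr => ?_) hpos
  have a1 : ‖l‖ < r₁ := hlr.trans_le (min_le_left _ _)
  have a2 : ‖l‖ < r₂ := hlr.trans_le ((min_le_right _ _).trans (min_le_left _ _))
  have a3 : ‖l‖ < 1 := hlr.trans_le ((min_le_right _ _).trans (min_le_right _ _))
  have hl2 : ‖l ^ 2‖ < r₂ := by
    rw [norm_pow]; nlinarith [norm_nonneg l]
  obtain ⟨u, hu⟩ := gd_quad hl h1 h2 (H₁ l hl a1) (H₂ _ (pow_ne_zero 2 hl) hl2)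
  set Y : X →L[ℂ] X := ↑u⁻¹ with hY
  have k1 : ∀ x, l ^ 2 • Y x - l • E (Y x) - F (Y x) = x := by
    intro x
    have := u.mul_inv
    rw [hu] at this
    have := congrArg (fun T : X →L[ℂ] X => T x) this
    simpa using this
  have k2 : ∀ x, l ^ 2 • Y x - l • Y (E x) - Y (F x) = x := by
    intro x
    have := u.inv_mul
    rw [hu] at this
    have := congrArg (fun T : X →L[ℂ] X => T x) this
    simpa using this
  refine ⟨⟨_, blk (l • Y) Y (l ^ 2 • Y - l • (E * Y) - 1) (l • Y - E * Y), ?_, ?_⟩, rfl⟩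
  · refine ContinuousLinearMap.ext fun ⟨x, y⟩ => Prod.ext ?_ ?_
    · simp [blk, Algebra.algebraMap_eq_smul_one]
      module
    · simp [blk, Algebra.algebraMap_eq_smul_one]
      linear_combination (norm := module) l • k1 x + k1 y
  · refine ContinuousLinearMap.ext fun ⟨x, y⟩ => Prod.ext ?_ ?_
    · simp [blk, Algebra.algebraMap_eq_smul_one]
      linear_combination (norm := module) k2 x
    · have k3 := congrArg E (k2 x)
      simp only [map_sub, map_smul] at k3
      simp [blk, Algebra.algebraMap_eq_smul_one]
      linear_combination (norm := module) l • k2 x - k3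
end

section
/- Let E, F be bounded operators on a Banach space such that E, F, and EF^π each have g-Drazin inverses, and suppose F^π E F^2 = 0 and F^π E F E = 0, where F^π = I − F F^d. Then the block operator matrix M = [[E, I], [F, 0]] has a g-Drazin inverse. -/
open Filter Topology

section Aux

variable {A : Type*} [NormedRing A]

lemma qn_iff (a : A) : IsQuasinilpotent a ↔
    ∀ ε : ℝ, 0 < ε → ∃ C : ℝ, 0 ≤ C ∧ ∀ n : ℕ, ‖a ^ n‖ ≤ C * ε ^ n := by
  constructor
  · intro h ε hε
    have h1 : ∀ᶠ n : ℕ in atTop, ‖a ^ n‖ ^ ((1 : ℝ) / n) < ε :=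
      (tendsto_order.1 h).2 ε hε
    obtain ⟨N, hN⟩ := eventually_atTop.1 h1
    refine ⟨1 + ∑ i ∈ Finset.range (N + 1), ‖a ^ i‖ / ε ^ i, by positivity, fun n => ?_⟩
    rw [← div_le_iff₀ (by positivity)]
    by_cases hn : n < N + 1
    · have := Finset.single_le_sum (f := fun i => ‖a ^ i‖ / ε ^ i)
        (fun i _ => by positivity) (Finset.mem_range.2 hn)
      linarith
    · have h2 := hN n (by omega)
      have hn0 : n ≠ 0 := by omega
      have h3 : ‖a ^ n‖ ≤ ε ^ n := by
        have := pow_le_pow_left₀ (by positivity) h2.le n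
        rwa [one_div, Real.rpow_inv_natCast_pow (norm_nonneg _) hn0] at this
      have h4 : ‖a ^ n‖ / ε ^ n ≤ 1 := by
        rw [div_le_one (by positivity)]; exact h3
      have : 0 ≤ ∑ i ∈ Finset.range (N + 1), ‖a ^ i‖ / ε ^ i := by positivity
      linarith
  · intro h
    refine tendsto_order.2 ⟨fun x hx => Eventually.of_forall fun n =>
      lt_of_lt_of_le hx (by positivity), fun x hx => ?_⟩
    obtain ⟨C, hC, hb⟩ := h (x / 4) (by positivity)
    have h2 : Tendsto (fun n : ℕ => C * (1 / 2 : ℝ) ^ n) atTop (𝓝 (C * 0)) :=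
      (tendsto_pow_atTop_nhds_zero_of_lt_one (by norm_num) (by norm_num)).const_mul C
    rw [mul_zero] at h2
    filter_upwards [(tendsto_order.1 h2).2 1 one_pos, eventually_ge_atTop 1] with n hn hn1
    have hn0 : n ≠ 0 := by omega
    have h3 : ‖a ^ n‖ ≤ (x / 2) ^ n := by
      calc ‖a ^ n‖ ≤ C * (x / 4) ^ n := hb n
        _ = C * (1 / 2) ^ n * (x / 2) ^ n := by
          rw [mul_assoc, ← mul_pow]; congr 2; ring
        _ ≤ 1 * (x / 2) ^ n := by gcongr
        _ = _ := one_mul _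
    calc ‖a ^ n‖ ^ ((1 : ℝ) / n) ≤ ((x / 2) ^ n) ^ ((1 : ℝ) / n) := by gcongr
      _ = x / 2 := by rw [one_div, Real.pow_rpow_inv_natCast (by positivity) hn0]
      _ < x := by linarith

lemma qn_zero : IsQuasinilpotent (0 : A) := by
  rw [qn_iff]
  intro ε hε
  refine ⟨‖(1 : A)‖, norm_nonneg _, fun n => ?_⟩
  rcases Nat.eq_zero_or_pos n with rfl | hn
  · simp
  · rw [zero_pow hn.ne', norm_zero]; positivity

/-- Bounds for all positive powers suffice. -/
lemma qn_of_succ (a : A)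
    (h : ∀ ε : ℝ, 0 < ε → ∃ C : ℝ, 0 ≤ C ∧ ∀ n : ℕ, ‖a ^ (n + 1)‖ ≤ C * ε ^ n) :
    IsQuasinilpotent a := by
  rw [qn_iff]
  intro ε hε
  obtain ⟨C, hC, hb⟩ := h ε hε
  refine ⟨‖(1 : A)‖ + C / ε, by positivity, fun n => ?_⟩
  rcases n with _ | n
  · simp; positivity
  · calc ‖a ^ (n + 1)‖ ≤ C * ε ^ n := hb n
      _ = C / ε * ε ^ (n + 1) := by field_simp; ring
      _ ≤ _ := by gcongr; linarith [norm_nonneg (1 : A)]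

lemma qn_swap {a b : A} (h : IsQuasinilpotent (a * b)) : IsQuasinilpotent (b * a) := by
  apply qn_of_succ
  rw [qn_iff] at h
  intro ε hε
  obtain ⟨C, hC, hb⟩ := h ε hε
  refine ⟨‖b‖ * C * ‖a‖, by positivity, fun n => ?_⟩
  have e : (b * a) ^ (n + 1) = b * (a * b) ^ n * a := by
    induction n with
    | zero => simp
    | succ n ih => rw [pow_succ, ih, pow_succ]; simp only [mul_assoc]
  rw [e]
  calc ‖b * (a * b) ^ n * a‖ ≤ ‖b * (a * b) ^ n‖ * ‖a‖ := norm_mul_le _ _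
    _ ≤ ‖b‖ * ‖(a * b) ^ n‖ * ‖a‖ := by gcongr; exact norm_mul_le _ _
    _ ≤ ‖b‖ * (C * ε ^ n) * ‖a‖ := by gcongr; exact hb n
    _ = _ := by ring

lemma qn_of_sq {z : A} (h : IsQuasinilpotent (z ^ 2)) : IsQuasinilpotent z := by
  rw [qn_iff] at h ⊢
  intro ε hε
  obtain ⟨C, hC, hb⟩ := h (ε ^ 2) (by positivity)
  refine ⟨C + C * ‖z‖ / ε, by positivity, fun n => ?_⟩
  rcases Nat.even_or_odd' n with ⟨k, rfl | rfl⟩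
  · calc ‖z ^ (2 * k)‖ ≤ C * (ε ^ 2) ^ k := by rw [pow_mul]; exact hb k
      _ = C * ε ^ (2 * k) := by rw [pow_mul]
      _ ≤ _ := by gcongr; linarith [show 0 ≤ C * ‖z‖ / ε by positivity]
  · calc ‖z ^ (2 * k + 1)‖ ≤ ‖z ^ (2 * k)‖ * ‖z‖ := by rw [pow_succ]; exact norm_mul_le _ _
      _ ≤ C * (ε ^ 2) ^ k * ‖z‖ := by gcongr; rw [pow_mul]; exact hb k
      _ = C * ‖z‖ / ε * ε ^ (2 * k + 1) := by rw [← pow_mul]; field_simp; ring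
      _ ≤ _ := by gcongr; linarith

lemma qn_sq {z : A} (h : IsQuasinilpotent z) : IsQuasinilpotent (z ^ 2) := by
  rw [qn_iff] at h ⊢
  intro ε hε
  obtain ⟨C, hC, hb⟩ := h (√ε) (by positivity)
  refine ⟨C, hC, fun n => ?_⟩
  have := hb (2 * n)
  rwa [pow_mul, pow_mul, Real.sq_sqrt hε.le] at this

lemma qn_add {x y : A} (hxy : x * y = 0) (hx : IsQuasinilpotent x) (hy : IsQuasinilpotent y) :
    IsQuasinilpotent (x + y) := by
  rw [qn_iff] at hx hy ⊢
  intro ε hε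
  obtain ⟨C, hC, hb⟩ := hx (ε / 2) (by positivity)
  obtain ⟨D, hD, hd⟩ := hy (ε / 2) (by positivity)
  set δ := ε / 2 with hδ
  have hδ0 : 0 < δ := by positivity
  have e : ∀ n : ℕ, x * (x + y) ^ n = x ^ (n + 1) := by
    intro n
    induction n with
    | zero => simp
    | succ n ih => rw [pow_succ, ← mul_assoc, ih, mul_add, pow_succ, mul_assoc, mul_assoc, hxy,
        mul_zero, add_zero, pow_succ _ (n+1), pow_succ, mul_assoc]
  have key : ∀ n k : ℕ, ‖y ^ k * (x + y) ^ n‖ ≤ (n + 1) * (D + D * C) * δ ^ (k + n) := by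
    intro n
    induction n with
    | zero =>
      intro k
      have : 0 ≤ D * C * δ ^ k := by positivity
      simp only [pow_zero, mul_one, Nat.cast_zero, zero_add, one_mul, add_zero]
      linarith [hd k]
    | succ n ih =>
      intro k
      have e2 : y ^ k * (x + y) ^ (n + 1) = y ^ (k + 1) * (x + y) ^ n + y ^ k * x ^ (n + 1) := by
        rw [pow_succ' (x + y), add_mul, e, mul_add, pow_succ y, mul_assoc, add_comm]
      have h1 := ih (k + 1)
      have h2 : ‖y ^ k * x ^ (n + 1)‖ ≤ D * C * δ ^ (k + (n + 1)) := by
        calc _ ≤ ‖y ^ k‖ * ‖x ^ (n + 1)‖ := norm_mul_le _ _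
          _ ≤ (D * δ ^ k) * (C * δ ^ (n + 1)) := by gcongr; exacts [hd k, hb _]
          _ = _ := by rw [pow_add]; ring
      have h3 : 0 ≤ D * δ ^ (k + (n + 1)) := by positivity
      rw [e2]
      refine (norm_add_le _ _).trans ?_
      rw [show k + 1 + n = k + (n + 1) by ring] at h1
      push_cast
      nlinarith
  refine ⟨D + D * C, by positivity, fun n => ?_⟩
  have h1 := key n 0
  simp only [pow_zero, one_mul, zero_add] at h1
  have h2 : ((n : ℝ) + 1) ≤ 2 ^ n := by
    exact_mod_cast Nat.lt_two_pow_self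
  calc _ ≤ _ := h1
    _ ≤ 2 ^ n * (D + D * C) * δ ^ n := by gcongr
    _ = (D + D * C) * (2 * δ) ^ n := by rw [mul_pow]; ring
    _ = _ := by rw [hδ]; congr 2; ring

/-- having a g-Drazin inverse -/
def GD (a : A) : Prop := ∃ b, IsGDrazinInverse a b

lemma GD_of_qn {a : A} (h : IsQuasinilpotent a) : GD a := ⟨0, by simp, by simp, by simpa using h⟩

lemma GD_cline {a b : A} (h : GD (a * b)) : GD (b * a) := by
  obtain ⟨d, h1, h2, h3⟩ := h
  have h1' : d * a * b = a * b * d := by rw [h1, mul_assoc]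
  have k1 : b * a * (b * d ^ 2 * a) = b * d * a := by
    calc _ = b * ((a * b) * d * d) * a := by noncomm_ring
      _ = b * d * a := by rw [h1, h2]
  have k2 : (b * d ^ 2 * a) * (b * a) = b * d * a := by
    calc _ = b * (d * (d * (a * b))) * a := by noncomm_ring
      _ = b * d * a := by rw [← h1, ← mul_assoc d, h2]
  refine ⟨b * d ^ 2 * a, by rw [k1, k2], ?_, ?_⟩
  · rw [k2]
    calc _ = b * (d * (a * b) * d * d) * a := by noncomm_ring
      _ = _ := by rw [h2, sq, mul_assoc b]
  · have : b * a - (b * a) ^ 2 * (b * d ^ 2 * a) = b * ((1 - a * b * d) * a) := by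
      rw [sq, mul_assoc (b * a), k1]; noncomm_ring
    rw [this]
    apply qn_swap
    convert h3 using 1
    calc _ = a * b - a * b * (d * (a * b)) := by noncomm_ring
      _ = _ := by rw [← h1]; noncomm_ring

lemma GD_sq {a : A} (h : GD a) : GD (a ^ 2) := by
  obtain ⟨d, h1, h2, h3⟩ := h
  have hc : Commute a d := h1
  have h4 : a * d * d = d := by rw [h1, h2]
  have h5 : a ^ 2 * d ^ 2 = a * d := by
    calc _ = a * (a * d * d) := by noncomm_ring
      _ = _ := by rw [h4]
  refine ⟨d ^ 2, (hc.pow_pow 2 2), ?_, ?_⟩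
  · rw [← (hc.pow_pow 2 2).eq, h5]
    rw [sq, ← mul_assoc, h4]
  · have := qn_sq h3
    convert this using 1
    have h6 : (a ^ 2) ^ 2 * d ^ 2 = a ^ 3 * d := by
      calc _ = a ^ 2 * (a ^ 2 * d ^ 2) := by noncomm_ring
        _ = _ := by rw [h5]; noncomm_ring
    rw [h6]
    have h7 : a ^ 2 * d * a = a ^ 3 * d := by rw [mul_assoc, ← h1]; noncomm_ring
    have h8 : a ^ 2 * d * (a ^ 2 * d) = a ^ 3 * d := by
      calc _ = a ^ 2 * d * a * (a * d) := by noncomm_ring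
        _ = a ^ 3 * (d * a * d) := by rw [h7]; noncomm_ring
        _ = _ := by rw [h2]
    rw [sq (a - _), sub_mul, mul_sub, mul_sub, h7, h8]
    noncomm_ring

/-- one-sided commutation -/
lemma comm_aux {a d c : A} (h : IsGDrazinInverse a d) (hc : a * c = c * a) :
    (1 - a * d) * c * (a * d) = 0 ∧ (a * d) * c * (1 - a * d) = 0 := by
  obtain ⟨h1, h2, h3⟩ := h
  have hid : a * d * (a * d) = a * d := by
    calc _ = a * (d * a * d) := by noncomm_ring
      _ = _ := by rw [h2]
  have hcd : Commute a d := h1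
  have hca : Commute a c := hc
  set u := a - a ^ 2 * d with hu
  have hq := (qn_iff u).1 h3
  have hu1 : u = (1 - a * d) * a := by
    rw [hu, sub_mul, mul_assoc a d a, ← h1]; noncomm_ring
  have hu2 : u = a * (1 - a * d) := by
    rw [hu]; noncomm_ring
  have hpi : ∀ n : ℕ, u ^ n * (1 - a * d) = (1 - a * d) * a ^ n := by
    intro n
    have cm : Commute a (1 - a * d) := (Commute.one_right a).sub_right
      ((Commute.refl a).mul_right hcd)
    have ip : (1 - a * d) * (1 - a * d) = 1 - a * d := by
      rw [sub_mul, one_mul, mul_sub, hid]; simp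
    induction n with
    | zero => simp
    | succ n ih =>
      rw [pow_succ', mul_assoc, ih, hu2, mul_assoc, ← mul_assoc (1 - a * d), ip, ← mul_assoc, cm.eq,
        mul_assoc, ← pow_succ']
  have cm : Commute a (1 - a * d) := (Commute.one_right a).sub_right
      ((Commute.refl a).mul_right hcd)
  have hp : ∀ n : ℕ, a ^ (n + 1) * d ^ (n + 1) = a * d := by
    intro n
    induction n with
    | zero => simp
    | succ n ih =>
      rw [pow_succ' a (n + 1), pow_succ d (n + 1), mul_assoc, ← mul_assoc (a ^ (n + 1)), ih,
        h1, h2, h1]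
  have lim : ∀ (x : A) (K : ℝ), 0 ≤ K → (∀ n : ℕ, ‖x‖ ≤ K * ‖u ^ (n + 1)‖ * ‖d‖ ^ (n + 1)) →
      x = 0 := by
    intro x K hK hx
    obtain ⟨C, hC, hb⟩ := hq (1 / (2 * (‖d‖ + 1))) (by positivity)
    have h2 : Tendsto (fun n : ℕ => K * C * (1 / 2 : ℝ) ^ n) atTop (𝓝 (K * C * 0)) :=
      (tendsto_pow_atTop_nhds_zero_of_lt_one (by norm_num) (by norm_num)).const_mul _
    rw [mul_zero] at h2
    rw [← norm_le_zero_iff]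
    refine ge_of_tendsto ((tendsto_add_atTop_iff_nat 1).2 h2) (Eventually.of_forall fun n => ?_)
    calc ‖x‖ ≤ K * ‖u ^ (n + 1)‖ * ‖d‖ ^ (n + 1) := hx n
      _ ≤ K * (C * (1 / (2 * (‖d‖ + 1))) ^ (n + 1)) * (‖d‖ + 1) ^ (n + 1) := by
        gcongr
        · exact hb _
        · linarith
      _ = K * C * ((1 / (2 * (‖d‖ + 1))) * (‖d‖ + 1)) ^ (n + 1) := by rw [mul_pow]; ring
      _ = _ := by congr 2; field_simp
  constructor
  · refine lim _ (‖1 - a * d‖ * ‖c‖) (by positivity) fun n => ?_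
    have e : (1 - a * d) * c * (a * d) = u ^ (n + 1) * ((1 - a * d) * c * d ^ (n + 1)) := by
      calc (1 - a * d) * c * (a * d) = (1 - a * d) * c * (a ^ (n + 1) * d ^ (n + 1)) := by rw [hp]
        _ = (1 - a * d) * (c * a ^ (n + 1)) * d ^ (n + 1) := by simp only [mul_assoc]
        _ = (1 - a * d) * a ^ (n + 1) * c * d ^ (n + 1) := by
          rw [← (hca.pow_left (n + 1)).eq]; simp only [mul_assoc]
        _ = _ := by rw [← hpi]; simp only [mul_assoc]
    rw [e]
    calc _ ≤ ‖u ^ (n + 1)‖ * ‖(1 - a * d) * c * d ^ (n + 1)‖ := norm_mul_le _ _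
      _ ≤ ‖u ^ (n + 1)‖ * (‖1 - a * d‖ * ‖c‖ * ‖d‖ ^ (n + 1)) := by
        gcongr
        refine (norm_mul_le _ _).trans ?_
        gcongr
        · exact norm_mul_le _ _
        · exact norm_pow_le' _ (Nat.succ_pos _)
      _ = _ := by ring
  · refine lim _ (‖1 - a * d‖ * ‖c‖) (by positivity) fun n => ?_
    have hcu : Commute u (1 - a * d) := by
      rw [hu2]; exact cm.mul_left (Commute.refl _)
    have e : (a * d) * c * (1 - a * d) = d ^ (n + 1) * c * (1 - a * d) * u ^ (n + 1) := by
      calc (a * d) * c * (1 - a * d) = (d ^ (n + 1) * a ^ (n + 1)) * c * (1 - a * d) := by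
            rw [← hp n, (hcd.pow_pow _ _).eq]
        _ = d ^ (n + 1) * (a ^ (n + 1) * c) * (1 - a * d) := by simp only [mul_assoc]
        _ = d ^ (n + 1) * c * (a ^ (n + 1) * (1 - a * d)) := by
          rw [(hca.pow_left (n + 1)).eq]; simp only [mul_assoc]
        _ = _ := by
          rw [(cm.pow_left _).eq, ← hpi, (hcu.pow_left _).eq]; simp only [mul_assoc]
    rw [e]
    calc _ ≤ ‖d ^ (n + 1) * c * (1 - a * d)‖ * ‖u ^ (n + 1)‖ := norm_mul_le _ _
      _ ≤ (‖d‖ ^ (n + 1) * ‖c‖ * ‖1 - a * d‖) * ‖u ^ (n + 1)‖ := by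
        gcongr
        refine (norm_mul_le _ _).trans ?_
        gcongr
        refine (norm_mul_le _ _).trans ?_
        gcongr
        exact norm_pow_le' _ (Nat.succ_pos _)
      _ = _ := by ring

lemma comm_gd {a d c : A} (h : IsGDrazinInverse a d) (hc : a * c = c * a) : c * d = d * c := by
  obtain ⟨k1, k2⟩ := comm_aux h hc
  obtain ⟨h1, h2, h3⟩ := h
  have h4 : a * d * d = d := by rw [h1, h2]
  have h5 : d * (a * d) = d := by rw [← mul_assoc, h2]
  have e : a * d * c = c * (a * d) := by
    have e1 : c * (a * d) = a * d * c * (a * d) := by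
      rw [← sub_eq_zero, ← k1]; noncomm_ring
    have e2 : a * d * c = a * d * c * (a * d) := by
      rw [← sub_eq_zero, ← k2]; noncomm_ring
    rw [e1, ← e2]
  calc c * d = c * (a * d) * d := by rw [mul_assoc, h4]
    _ = d * (a * c) * d := by rw [← e, h1]; simp only [mul_assoc]
    _ = d * (c * (a * d)) := by rw [hc]; simp only [mul_assoc]
    _ = d * (a * d) * c := by rw [← e]; simp only [mul_assoc]
    _ = d * c := by rw [h5]

lemma GD_of_sq {a : A} (h : GD (a ^ 2)) : GD a := by
  obtain ⟨d, h⟩ := h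
  have hc : a * d = d * a := comm_gd h (by noncomm_ring)
  obtain ⟨h1, h2, h3⟩ := h
  refine ⟨a * d, ?_, ?_, ?_⟩
  · rw [mul_assoc, ← hc]
  · calc _ = a * (d * a ^ 2 * d) := by noncomm_ring
      _ = _ := by rw [h2]
  · apply qn_of_sq
    convert h3 using 1
    have h8 : a ^ 3 * d * (a ^ 3 * d) = a ^ 4 * d := by
      calc _ = a ^ 3 * (d * a) * (a ^ 2 * d) := by noncomm_ring
        _ = a ^ 4 * (d * a ^ 2 * d) := by rw [← hc]; noncomm_ring
        _ = _ := by rw [h2]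
    have h7 : a ^ 3 * d * a = a ^ 4 * d := by rw [mul_assoc, ← hc]; noncomm_ring
    have h6 : a ^ 2 * (a * d) = a ^ 3 * d := by noncomm_ring
    rw [h6, sq (a - _), sub_mul, mul_sub, mul_sub, h7, h8]
    noncomm_ring

variable [CompleteSpace A]

lemma sylv_aux (u v c : A) (f : ℕ → A) (hs : Summable f) (h0 : f 0 = c)
    (h : ∀ n, f (n + 1) = u * f n * v) : ∃ S, S = c + u * S * v := by
  refine ⟨∑' n, f n, ?_⟩
  conv_lhs => rw [hs.tsum_eq_zero_add, h0]
  simp only [h]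
  rw [(hs.mul_left u).tsum_mul_right, hs.tsum_mul_left]

lemma sylv_summable {u : A} (hu : IsQuasinilpotent u) (v : A) (K : ℝ) (hK : 0 ≤ K) (f : ℕ → A)
    (hf : ∀ n, ‖f (n + 1)‖ ≤ K * ‖u ^ (n + 1)‖ * ‖v‖ ^ (n + 1)) : Summable f := by
  obtain ⟨C, hC, hb⟩ := (qn_iff u).1 hu (1 / (2 * (‖v‖ + 1))) (by positivity)
  rw [← summable_nat_add_iff 1]
  refine Summable.of_norm_bounded (g := fun n => K * C * (1 / 2 : ℝ) ^ (n + 1)) ?_ fun n => ?_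
  · exact ((summable_nat_add_iff 1).2
      (summable_geometric_of_lt_one (by norm_num) (by norm_num))).mul_left _
  calc _ ≤ K * ‖u ^ (n + 1)‖ * ‖v‖ ^ (n + 1) := hf n
    _ ≤ K * (C * (1 / (2 * (‖v‖ + 1))) ^ (n + 1)) * (‖v‖ + 1) ^ (n + 1) := by
      gcongr
      · exact hb _
      · linarith
    _ = K * C * ((1 / (2 * (‖v‖ + 1))) * (‖v‖ + 1)) ^ (n + 1) := by rw [mul_pow]; ring
    _ = _ := by congr 2; field_simp

lemma sylv1 {u : A} (hu : IsQuasinilpotent u) (v c : A) : ∃ S, S = c + u * S * v := by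
  refine sylv_aux u v c (fun n => u ^ n * c * v ^ n) ?_ (by simp) ?_
  · refine sylv_summable hu v ‖c‖ (norm_nonneg _) _ fun n => ?_
    calc _ ≤ ‖u ^ (n + 1)‖ * ‖c‖ * ‖v‖ ^ (n + 1) := by
          refine (norm_mul_le _ _).trans ?_
          gcongr
          · exact norm_mul_le _ _
          · exact norm_pow_le' _ (Nat.succ_pos _)
      _ = _ := by ring
  · intro n; rw [pow_succ' u, pow_succ v]; simp only [mul_assoc]

lemma sylv2 {v : A} (hv : IsQuasinilpotent v) (u c : A) : ∃ S, S = c + u * S * v := by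
  refine sylv_aux u v c (fun n => u ^ n * c * v ^ n) ?_ (by simp) ?_
  · refine sylv_summable hv u ‖c‖ (norm_nonneg _) _ fun n => ?_
    calc _ ≤ ‖u‖ ^ (n + 1) * ‖c‖ * ‖v ^ (n + 1)‖ := by
          refine (norm_mul_le _ _).trans ?_
          gcongr
          refine (norm_mul_le _ _).trans ?_
          gcongr
          exact norm_pow_le' _ (Nat.succ_pos _)
      _ = _ := by ring
  · intro n; rw [pow_succ' u, pow_succ v]; simp only [mul_assoc]

lemma GD_add {P Q : A} (hPQ : P * Q = 0) (hP : GD P) (hQ : GD Q) : GD (P + Q) := by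
  obtain ⟨d, p1, p2, p3⟩ := hP
  obtain ⟨g, q1, q2, q3⟩ := hQ
  have p4 : d * d * P = d := by rw [mul_assoc, ← p1, ← mul_assoc, p2]
  have q4 : Q * g * g = g := by rw [q1, q2]
  have dQ : d * Q = 0 := by rw [← p4, mul_assoc, hPQ, mul_zero]
  have Pg : P * g = 0 := by rw [← q4, ← mul_assoc, ← mul_assoc, hPQ]; simp
  have dg : d * g = 0 := by rw [← q4, ← mul_assoc, ← mul_assoc, dQ]; simp
  obtain ⟨S, hS⟩ := sylv1 q3 d ((1 - Q * g) * d)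
  obtain ⟨R, hR⟩ := sylv2 p3 g (g * (1 - P * d))
  have Qi : Q * g * (Q * g) = Q * g := by
    calc _ = Q * (g * Q * g) := by noncomm_ring
      _ = _ := by rw [q2]
  have Pi : P * d * (P * d) = P * d := by
    calc _ = P * (d * P * d) := by noncomm_ring
      _ = _ := by rw [p2]
  have dPd : d * (P * d) = d := by rw [← mul_assoc, p2]
  have S1 : Q * g * S = 0 := by
    have a1 : Q * g * (1 - Q * g) = 0 := by rw [mul_sub, Qi]; simp
    have a2 : Q * g * (Q - Q ^ 2 * g) = 0 := by
      calc _ = Q * (g * Q) * (1 - Q * g) := by noncomm_ring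
        _ = Q * (Q * g * (1 - Q * g)) := by rw [← q1]; simp only [mul_assoc]
        _ = 0 := by rw [a1, mul_zero]
    rw [hS, mul_add, ← mul_assoc, a1, ← mul_assoc, ← mul_assoc, a2]; simp
  have S2 : S * (P * d) = S := by
    conv_lhs => rw [hS]
    rw [add_mul, mul_assoc _ d, mul_assoc _ d, dPd, ← hS]
  have S3 : S = (1 - Q * g) * d + Q * S * d := by
    conv_lhs => rw [hS]
    have : (Q - Q ^ 2 * g) * S = Q * S - Q * (Q * g * S) := by noncomm_ring
    rw [this, S1, mul_zero, sub_zero]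
  have R1 : R * (P * d) = 0 := by
    have a1 : (1 - P * d) * (P * d) = 0 := by rw [sub_mul, Pi]; simp
    have a2 : (P - P ^ 2 * d) * (P * d) = 0 := by
      calc _ = P * ((1 - P * d) * (P * d)) := by noncomm_ring
        _ = 0 := by rw [a1, mul_zero]
    rw [hR, add_mul, mul_assoc g, a1, mul_assoc (g * R), a2]; simp
  have R2 : Q * g * R = R := by
    conv_lhs => rw [hR]
    rw [mul_add, ← mul_assoc, q4, ← mul_assoc, ← mul_assoc, q4, ← hR]
  have R3 : R = g * (1 - P * d) + g * R * P := by
    conv_lhs => rw [hR]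
    have : g * R * (P - P ^ 2 * d) = g * R * P - g * (R * (P * d)) * P := by
      have : P ^ 2 * d = P * d * P := by rw [mul_assoc, ← p1]; noncomm_ring
      rw [this]; noncomm_ring
    rw [this, R1]; simp
  have PS : P * S = P * d := by
    calc P * S = P * d - P * Q * g * d + P * Q * S * d := by
          conv_lhs => rw [S3]
          noncomm_ring
      _ = _ := by rw [hPQ]; simp
  have PR : P * R = 0 := by rw [← R2, ← mul_assoc, ← mul_assoc, hPQ]; simp
  have QR : Q * R = Q * g * (1 - P * d) + R * P := by
    calc Q * R = Q * g * (1 - P * d) + Q * g * R * P := by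
          conv_lhs => rw [R3]
          noncomm_ring
      _ = _ := by rw [R2]
  have SP : S * P = (1 - Q * g) * (P * d) + Q * S := by
    calc S * P = (1 - Q * g) * (d * P) + Q * (S * (d * P)) := by
          conv_lhs => rw [S3]
          noncomm_ring
      _ = _ := by rw [← p1, S2]
  have SQ : S * Q = 0 := by
    rw [← S2, mul_assoc, mul_assoc, dQ]; simp
  have Sg : S * g = 0 := by
    rw [← S2, mul_assoc, mul_assoc, dg]; simp
  have RQ : R * Q = Q * g := by
    calc R * Q = g * Q - g * P * (d * Q) + g * R * (P * Q) := by
          conv_lhs => rw [R3]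
          noncomm_ring
      _ = _ := by rw [hPQ, dQ, q1]; simp
  have SR : S * R = 0 := by rw [← R2, ← mul_assoc, ← mul_assoc, SQ]; simp
  have RR : R * R = g * R := by
    calc R * R = (R * Q) * g * R := by
          rw [mul_assoc, mul_assoc, ← mul_assoc Q, R2]
      _ = _ := by rw [RQ, q4]
  have TD : (P + Q) * (S + R) = P * d + Q * S + Q * g * (1 - P * d) + R * P := by
    rw [add_mul, mul_add, mul_add, PS, PR, QR]; abel
  have DT : (S + R) * (P + Q) = P * d + Q * S + Q * g * (1 - P * d) + R * P := by
    rw [add_mul, mul_add, mul_add, SP, SQ, RQ]; noncomm_ring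
  set w := P * d + Q * S + Q * g * (1 - P * d) + R * P with hw
  have Dw : (S + R) * w = S + R := by
    have e1 : S * w = S := by
      rw [hw]
      calc _ = S * (P * d) + S * Q * S + S * Q * g * (1 - P * d) + S * R * P := by noncomm_ring
        _ = _ := by rw [S2, SQ, SR]; simp
    have e2 : R * w = R := by
      rw [hw]
      calc _ = R * (P * d) + R * Q * S + R * Q * g * (1 - P * d) + R * R * P := by noncomm_ring
        _ = _ := by rw [R1, RQ, RR, S1, q4]; conv_rhs => rw [R3]
                    simp
    rw [add_mul, e1, e2]
  have ww : w * w = w := by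
    calc w * w = (P + Q) * ((S + R) * w) := by rw [← mul_assoc, TD]
      _ = w := by rw [Dw, TD]
  have Tw : (P + Q) * w = w * (P + Q) := by
    calc _ = (P + Q) * ((S + R) * (P + Q)) := by rw [DT]
      _ = _ := by rw [← mul_assoc, TD]
  refine ⟨S + R, by rw [TD, DT], by rw [mul_assoc, TD, Dw], ?_⟩
  have wi : (1 - w) * (1 - w) = 1 - w := by rw [sub_mul, one_mul, mul_sub, ww]; simp
  have hx : P * (1 - w) = P - P ^ 2 * d := by
    rw [hw]
    calc _ = P - P ^ 2 * d - P * Q * S - P * Q * g * (1 - P * d) - P * R * P := by noncomm_ring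
      _ = _ := by rw [hPQ, PR]; simp
  have hy : (1 - w) * Q = Q - Q ^ 2 * g := by
    rw [hw]
    calc _ = Q - P * (d * Q) - Q * (S * Q) - Q * (g * Q) + Q * g * P * (d * Q) - R * (P * Q) := by
          noncomm_ring
      _ = _ := by rw [hPQ, SQ, dQ, ← q1]; simp; noncomm_ring
  have hZ : P + Q - (P + Q) ^ 2 * (S + R) = (1 - w) * (P - P ^ 2 * d) + (Q - Q ^ 2 * g) * (1 - w) := by
    rw [sq, mul_assoc, TD, ← hx, ← hy]
    calc _ = (P + Q) * (1 - w) := by noncomm_ring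
      _ = (P + Q) * ((1 - w) * (1 - w)) := by rw [wi]
      _ = ((P + Q) - (P + Q) * w) * (1 - w) := by noncomm_ring
      _ = _ := by rw [Tw]; noncomm_ring
  rw [hZ]
  apply qn_add
  · calc _ = (1 - w) * ((P - P ^ 2 * d) * (Q - Q ^ 2 * g)) * (1 - w) := by simp only [mul_assoc]
      _ = (1 - w) * ((P - P ^ 2 * d) * Q * (1 - Q * g)) * (1 - w) := by noncomm_ring
      _ = (1 - w) * ((P * Q - P ^ 2 * (d * Q)) * (1 - Q * g)) * (1 - w) := by
        simp only [sub_mul, mul_assoc]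
      _ = 0 := by rw [hPQ, dQ]; simp
  · apply qn_swap
    rwa [← hx, mul_assoc, wi, hx]
  · apply qn_swap
    rwa [← hy, ← mul_assoc, wi, hy]

lemma GD_nil {a : A} (h : a ^ 2 = 0) : GD a :=
  GD_of_qn (qn_of_sq (by rw [h]; exact qn_zero))

lemma GD_add2 {P Q : A} (h1 : P * Q * P = 0) (h2 : P * Q * Q = 0) (hP : GD P) (hQ : GD Q) :
    GD (P + Q) := by
  have n : GD (P * Q) := GD_nil (by rw [sq, ← mul_assoc, h1, zero_mul])
  have a1 : GD (P * Q + P ^ 2) := GD_add (by rw [sq, ← mul_assoc, h1, zero_mul]) n (GD_sq hP)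
  have a2 : GD (P * Q + Q ^ 2) := GD_add (by rw [sq, ← mul_assoc, h2, zero_mul]) n (GD_sq hQ)
  have a3 : GD (Q * (P + Q)) := by
    apply GD_cline
    convert a2 using 1; noncomm_ring
  apply GD_of_sq
  have : (P + Q) ^ 2 = (P * Q + P ^ 2) + Q * (P + Q) := by noncomm_ring
  rw [this]
  refine GD_add ?_ a1 a3
  calc _ = P * Q * Q * (P + Q) + P * (P * Q * P) + P * (P * Q * Q) := by noncomm_ring
    _ = 0 := by rw [h1, h2]; simp

end Aux

section Blk

variable {X : Type*} [NormedAddCommGroup X] [NormedSpace ℂ X]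

lemma blk_mul (a b c d a' b' c' d' : X →L[ℂ] X) :
    blk a b c d * blk a' b' c' d' =
      blk (a * a' + b * c') (a * b' + b * d') (c * a' + d * c') (c * b' + d * d') := by
  ext x <;> simp [blk] <;> abel

lemma blk_add (a b c d a' b' c' d' : X →L[ℂ] X) :
    blk a b c d + blk a' b' c' d' = blk (a + a') (b + b') (c + c') (d + d') := by
  ext x <;> simp [blk]

lemma blk_zero : blk (0 : X →L[ℂ] X) 0 0 0 = 0 := by
  ext x <;> simp [blk]

lemma blk_sub_one (a b : X →L[ℂ] X) : blk a 0 0 0 - blk b 0 0 0 = blk (a - b) 0 0 0 := by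
  ext x <;> simp [blk]

lemma blk_qn {z : X →L[ℂ] X} (h : IsQuasinilpotent z) : IsQuasinilpotent (blk z 0 0 0) := by
  have e : blk z 0 0 0 = (ContinuousLinearMap.inl ℂ X X) ∘L z ∘L (ContinuousLinearMap.fst ℂ X X) := by
    ext x <;> simp [blk]
  have e2 : ∀ n : ℕ, (blk z 0 0 0) ^ (n + 1) = blk (z ^ (n + 1)) 0 0 0 := by
    intro n
    induction n with
    | zero => simp
    | succ n ih => rw [pow_succ, ih, blk_mul, pow_succ z (n + 1)]; simp
  apply qn_of_succ
  intro ε hε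
  obtain ⟨C, hC, hb⟩ := (qn_iff z).1 h ε hε
  refine ⟨C * ε, by positivity, fun n => ?_⟩
  rw [e2]
  have : ‖blk (z ^ (n + 1)) 0 0 0‖ ≤ ‖z ^ (n + 1)‖ := by
    refine ContinuousLinearMap.opNorm_le_bound _ (norm_nonneg _) fun x => ?_
    have : blk (z ^ (n + 1)) 0 0 0 x = ((z ^ (n + 1)) x.1, 0) := by simp [blk]
    rw [this, Prod.norm_mk, norm_zero, max_eq_left (norm_nonneg _)]
    exact ((z ^ (n + 1)).le_opNorm _).trans (by gcongr; exact norm_fst_le x)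
  calc _ ≤ _ := this
    _ ≤ C * ε ^ (n + 1) := hb _
    _ = _ := by ring

lemma blk_GD {z : X →L[ℂ] X} (h : GD z) : GD (blk z 0 0 0) := by
  obtain ⟨d, h1, h2, h3⟩ := h
  refine ⟨blk d 0 0 0, ?_, ?_, ?_⟩
  · simp [blk_mul, h1]
  · simp [blk_mul, h2]
  · simp only [sq, blk_mul, mul_zero, zero_mul, add_zero, blk_sub_one]
    rw [← sq]; exact blk_qn h3

lemma blk_qn' {z : X →L[ℂ] X} (h : IsQuasinilpotent z) : IsQuasinilpotent (blk 0 0 0 z) := by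
  have : blk 0 0 0 z = blk 0 0 1 0 * blk 0 z 0 0 := by simp [blk_mul]
  rw [this]
  apply qn_swap
  simpa [blk_mul] using blk_qn h

/-- The part of the matrix on the quasinilpotent side. -/
lemma blk_main [CompleteSpace X] {e f p : X →L[ℂ] X} (he : GD e) (hf : IsQuasinilpotent f)
    (hep : e * p = e) (hpe : p * e = e) (hpf : p * f = f) (hfp : f * p = f)
    (h1 : e * f * f = 0) (h2 : e * f * e = 0) : GD (blk e p f 0) := by
  apply GD_of_sq
  have : (blk e p f 0) ^ 2 = blk (e * e) e 0 0 + blk f 0 (f * e) f := by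
    rw [sq, blk_mul, blk_add]; simp [hep, hpf, hfp]
  rw [this]
  apply GD_add2
  · have h2' : e * (f * e) = 0 := by rw [← mul_assoc, h2]
    have h3 : ∀ x, e * (f * (e * x)) = 0 := fun x => by
      rw [← mul_assoc f, ← mul_assoc, h2', zero_mul]
    simp [blk_mul, mul_assoc, h2', h3, blk_zero, add_mul]
  · have h2' : e * (f * e) = 0 := by rw [← mul_assoc, h2]
    have h1' : e * (f * f) = 0 := by rw [← mul_assoc, h1]
    have h3 : ∀ x, e * (f * (e * x)) = 0 := fun x => by
      rw [← mul_assoc f, ← mul_assoc, h2', zero_mul]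
    have h4 : ∀ x, e * (f * (f * x)) = 0 := fun x => by
      rw [← mul_assoc f, ← mul_assoc, h1', zero_mul]
    simp [blk_mul, mul_assoc, h2', h1', h3, h4, blk_zero, add_mul]
  · have : blk (e * e) e 0 0 = blk e 0 0 0 * blk e 1 0 0 := by simp [blk_mul]
    rw [this]
    apply GD_cline
    have := GD_sq (blk_GD he)
    simpa [blk_mul, sq] using this
  · apply GD_of_qn
    have : blk f 0 (f * e) f = (blk f 0 0 0 + blk 0 0 (f * e) 0) + blk 0 0 0 f := by
      simp [blk_add]
    rw [this]
    apply qn_add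
    · simp [blk_add, blk_mul, blk_zero]
    · apply qn_add
      · simp [blk_mul, blk_zero]
      · exact blk_qn hf
      · apply qn_of_sq
        simp only [sq, blk_mul, mul_zero, zero_mul, add_zero, blk_zero]
        exact qn_zero
    · exact blk_qn' hf

end Blk

theorem stmt9 {X : Type*} [NormedAddCommGroup X] [NormedSpace ℂ X] [CompleteSpace X]
    (E F Fd : X →L[ℂ] X) (hF : IsGDrazinInverse F Fd)
    (hE : ∃ e, IsGDrazinInverse E e)
    (hEFpi : ∃ y, IsGDrazinInverse (E * (1 - F * Fd)) y)
    (h1 : (1 - F * Fd) * E * F ^ 2 = 0)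
    (h2 : (1 - F * Fd) * E * F * E = 0) :
    ∃ m, IsGDrazinInverse (blk E 1 F 0) m := by
  change GD (blk E 1 F 0)
  obtain ⟨c1, c2, c3⟩ := hF
  have hqq : F * Fd * (F * Fd) = F * Fd := by
    calc _ = F * (Fd * F * Fd) := by noncomm_ring
      _ = _ := by rw [c2]
  obtain ⟨q, hq⟩ : ∃ q, q = F * Fd := ⟨_, rfl⟩
  obtain ⟨p, hp⟩ : ∃ p, p = 1 - q := ⟨_, rfl⟩
  rw [← hq] at hqq
  rw [← hq, ← hp] at h1 h2 hEFpi
  have hpq1 : p + q = 1 := by rw [hp]; simp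
  have hpq : p * q = 0 := by rw [hp, sub_mul, hqq]; simp
  have hqp : q * p = 0 := by rw [hp, mul_sub, hqq]; simp
  have hpp : p * p = p := by conv_lhs => rw [hp, sub_mul, ← hp, hqp]; simp
                             skip
  have hqF : q * F = F * q := by rw [hq, mul_assoc, ← c1]
  have hpF : p * F = F * p := by rw [hp, sub_mul, mul_sub, hqF]; simp
  have hFdF : Fd * F = q := by rw [hq, c1]
  have hqFd : q * Fd = Fd := by rw [← hFdF, c2]
  have hFdq : Fd * q = Fd := by rw [hq, ← mul_assoc, c2]
  have hq2 : F ^ 2 * Fd ^ 2 = q := by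
    calc _ = F * (F * Fd * Fd) := by noncomm_ring
      _ = _ := by rw [← hq, hqFd, hq]
  have hpEq : p * E * q = 0 := by rw [← hq2, ← mul_assoc, h1, zero_mul]
  have hqE : ∀ x, p * (E * (q * x)) = 0 := fun x => by
    rw [← mul_assoc, ← mul_assoc, hpEq, zero_mul]
  have he : GD (p * (E * p)) := by
    apply GD_cline
    rw [mul_assoc, hpp]; exact hEFpi
  have hf : IsQuasinilpotent (p * F) := by
    convert c3 using 1
    rw [hpF, hp, hq]; noncomm_ring
  have hb : GD (blk (p * (E * p)) p (p * F) 0) := by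
    apply blk_main he hf
    · rw [mul_assoc, mul_assoc, hpp]
    · rw [← mul_assoc, hpp]
    · rw [← mul_assoc, hpp]
    · rw [hpF, mul_assoc, hpp]
    · calc _ = p * E * (p * p) * F * (p * F) := by simp only [mul_assoc]
        _ = p * E * (p * F) * (p * F) := by rw [hpp]; simp only [mul_assoc]
        _ = p * E * F * (p * p) * F := by rw [hpF]; simp only [mul_assoc]; rw [← hpF]
        _ = p * E * F * (p * F) := by rw [hpp]; simp only [mul_assoc]
        _ = p * E * F ^ 2 * p := by rw [hpF]; noncomm_ring
        _ = 0 := by rw [h1, zero_mul]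
    · have e1 : p * E * F * q * E = 0 := by
        calc _ = p * E * F ^ 2 * Fd * E := by rw [hq]; noncomm_ring
          _ = 0 := by rw [h1]; simp
      calc _ = p * E * (p * p) * F * (p * E) * p := by simp only [mul_assoc]
        _ = p * E * (p * F) * (p * E) * p := by rw [hpp]; simp only [mul_assoc]
        _ = p * E * F * (p * p) * E * p := by rw [hpF]; simp only [mul_assoc]
        _ = p * E * F * (1 - q) * E * p := by rw [hpp, hp]
        _ = (p * E * F * E - p * E * F * q * E) * p := by noncomm_ring
        _ = 0 := by rw [h2, e1]; simp
  have ha : GD (blk (q * (E * q)) q (q * F) 0) := by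
    have t1 : ∀ x, q * (q * x) = q * x := fun x => by rw [← mul_assoc, hqq]
    have l : blk (q * (E * q)) q (q * F) 0 * blk 0 Fd q (-(q * (E * Fd))) = blk q 0 0 q := by
      simp [blk_mul, mul_assoc, hqq, t1, hqFd, ← hq]
    have r : blk 0 Fd q (-(q * (E * Fd))) * blk (q * (E * q)) q (q * F) 0 = blk q 0 0 q := by
      have t2 : Fd * (q * F) = q := by rw [← mul_assoc, hFdq, hFdF]
      simp [blk_mul, mul_assoc, hqq, t1, hFdq, t2]
    refine ⟨blk 0 Fd q (-(q * (E * Fd))), by rw [l, r], ?_, ?_⟩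
    · rw [r]; simp [blk_mul, t1, hqFd, hqq]
    · rw [sq, mul_assoc, l]
      have : blk (q * (E * q)) q (q * F) 0 * blk q 0 0 q = blk (q * (E * q)) q (q * F) 0 := by
        simp [blk_mul, mul_assoc, hqq, ← hqF, t1]
      rw [this, sub_self]
      exact qn_zero
  have hc : GD (blk (q * (E * p)) 0 0 0) := by
    apply GD_nil
    have : p * (q * (E * p)) = 0 := by rw [← mul_assoc, hpq, zero_mul]
    simp [sq, blk_mul, mul_assoc, this, blk_zero]
  have hsum : blk E 1 F 0 = blk (p * (E * p)) p (p * F) 0 +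
      (blk (q * (E * p)) 0 0 0 + blk (q * (E * q)) q (q * F) 0) := by
    have e1 : E = p * (E * p) + (q * (E * p) + q * (E * q)) := by
      calc E = (p + q) * E * (p + q) := by rw [hpq1]; simp
        _ = p * (E * p) + (q * (E * p) + q * (E * q)) + p * E * q := by noncomm_ring
        _ = _ := by rw [hpEq, add_zero]
    have e2 : F = p * F + q * F := by rw [← add_mul, hpq1, one_mul]
    simp only [blk_add, zero_add, add_zero]
    rw [← e1, ← e2, hpq1]
  rw [hsum]
  have s1 : ∀ x, p * (q * x) = 0 := fun x => by rw [← mul_assoc, hpq, zero_mul]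
  have s2 : F * p = p * F := hpF.symm
  have s3 : p * (F * q) = 0 := by rw [← mul_assoc, hpF, mul_assoc, hpq, mul_zero]
  have s4 : ∀ x, p * (F * (q * x)) = 0 := fun x => by
    rw [← mul_assoc F, ← mul_assoc, s3, zero_mul]
  apply GD_add
  · simp [blk_add, blk_mul, mul_assoc, mul_add, s1, s3, s4, hpq, blk_zero]
  · exact hb
  · apply GD_add
    · simp [blk_mul, mul_assoc, s1, hpq, blk_zero]
    · exact hc
    · exact ha
end
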